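/- Let L ≥ ‖D‖², fix a row index l, let z* ∈ ℝⁿ with S* = supp(z*), assume the Gram matrix (D_{:,S*})ᵀ D_{:,S*} is invertible with smallest eigenvalue μ > 0, and let J*_l be the associated closed-form Jacobian. Let K and N be integers with 1 ≤ K ≤ N, let Δ ≥ 0, and let z_{N−K}, …, z_N ∈ ℝⁿ satisfy supp(z_k) = S* and ‖z_k − z*‖ ≤ (1 − μ/L)^{k−(N−K)} (2Δ/L) for every k ∈ {N−K, …, N}. Define J_{N−K} = 0 and J_{k+1} = 1_{S*} ⊙ (G J_k + u^{z_k}) for N−K ≤ k ≤ N−1. Then, in ℓ²-operator norm, ‖J_N − J*_l‖ ≤ (1 − μ/L)^K ‖J*_l‖ + K (1 − μ/L)^{K−1} ‖D_l‖ (4Δ/L²). -/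

import Mathlib

open scoped BigOperators
open Matrix

noncomputable def eunorm {α : Type*} [Fintype α] (v : α → ℝ) : ℝ :=
  Real.sqrt (∑ i, v i ^ 2)

noncomputable def frobnorm {α β : Type*} [Fintype α] [Fintype β] (A : Matrix α β ℝ) : ℝ :=
  Real.sqrt (∑ i, ∑ j, A i j ^ 2)

noncomputable def l2opnorm {α β : Type*} [Fintype α] [Fintype β] (A : Matrix α β ℝ) : ℝ :=
  sInf {c : ℝ | 0 ≤ c ∧ ∀ v : β → ℝ, eunorm (A.mulVec v) ≤ c * eunorm v}

open scoped Classical in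
noncomputable def supp {n : ℕ} (z : Fin n → ℝ) : Finset (Fin n) :=
  Finset.univ.filter fun i => z i ≠ 0

noncomputable def rowMask {n : ℕ} (S : Finset (Fin n)) (M : Matrix (Fin n) (Fin n) ℝ) :
    Matrix (Fin n) (Fin n) ℝ :=
  Matrix.of fun i j => if i ∈ S then M i j else 0

def restrVec {n : ℕ} (S : Finset (Fin n)) (h : Fin n → ℝ) : Fin n → ℝ :=
  fun i => if i ∈ S then h i else 0

def colSub {m n : ℕ} (D : Matrix (Fin m) (Fin n) ℝ) (S : Finset (Fin n)) :
    Matrix (Fin m) {i // i ∈ S} ℝ :=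
  D.submatrix id Subtype.val

noncomputable def gram {m n : ℕ} (D : Matrix (Fin m) (Fin n) ℝ) (S : Finset (Fin n)) :
    Matrix {i // i ∈ S} {i // i ∈ S} ℝ :=
  (colSub D S)ᵀ * colSub D S

noncomputable def Nmat {m n : ℕ} (D : Matrix (Fin m) (Fin n) ℝ) (y : Fin m → ℝ)
    (l : Fin m) (z : Fin n → ℝ) : Matrix (Fin n) (Fin n) ℝ :=
  Matrix.vecMulVec (D l) z + (dotProduct (D l) z - y l) • (1 : Matrix (Fin n) (Fin n) ℝ)

noncomputable def umat {m n : ℕ} (D : Matrix (Fin m) (Fin n) ℝ) (y : Fin m → ℝ)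
    (l : Fin m) (L : ℝ) (z : Fin n → ℝ) : Matrix (Fin n) (Fin n) ℝ :=
  (-(1 / L)) • Nmat D y l z

noncomputable def Gmat {m n : ℕ} (D : Matrix (Fin m) (Fin n) ℝ) (L : ℝ) :
    Matrix (Fin n) (Fin n) ℝ :=
  1 - (1 / L) • (Dᵀ * D)

noncomputable def Jstar {m n : ℕ} (D : Matrix (Fin m) (Fin n) ℝ) (y : Fin m → ℝ)
    (l : Fin m) (z : Fin n → ℝ) (S : Finset (Fin n)) : Matrix (Fin n) (Fin n) ℝ :=
  Matrix.of fun i j =>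
    if h : i ∈ S then
      (-((gram D S)⁻¹ * (Nmat D y l z).submatrix (Subtype.val : {i // i ∈ S} → Fin n) id))
        ⟨i, h⟩ j
    else 0

noncomputable def Rmap {m n : ℕ} (D : Matrix (Fin m) (Fin n) ℝ) (y : Fin m → ℝ)
    (zstar : Fin n → ℝ) (J : Fin m → Matrix (Fin n) (Fin n) ℝ) (S : Finset (Fin n))
    (h : Fin n → ℝ) : Matrix (Fin m) (Fin n) ℝ :=
  Matrix.of fun l j =>
    ((J l)ᵀ.mulVec ((Dᵀ * D).mulVec (restrVec S h))) j
      + (D.mulVec (restrVec S h)) l * zstar j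
      + (D.mulVec zstar - y) l * restrVec S h j

noncomputable def mapOpNorm {m n : ℕ} (Φ : (Fin n → ℝ) → Matrix (Fin m) (Fin n) ℝ) : ℝ :=
  sInf {c : ℝ | 0 ≤ c ∧ ∀ h : Fin n → ℝ, frobnorm (Φ h) ≤ c * eunorm h}

noncomputable def Mmat {m n : ℕ} (D : Matrix (Fin m) (Fin n) ℝ) (Sstar E : Finset (Fin n))
    (U : Matrix (Fin n) (Fin n) ℝ) : Matrix (Fin n) (Fin n) ℝ :=
  Matrix.of fun i j =>
    if h : i ∈ E then
      U i j -
        ((colSub D E)ᵀ * colSub D Sstar * (gram D Sstar)⁻¹ *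
          U.submatrix (Subtype.val : {i // i ∈ Sstar} → Fin n) id) ⟨i, h⟩ j
    else 0

noncomputable def Cmat {m n : ℕ} (D : Matrix (Fin m) (Fin n) ℝ) (Sstar E : Finset (Fin n)) :
    Matrix (Fin n) (Fin n) ℝ :=
  Matrix.of fun i j =>
    if h : i ∈ E then
      if h' : j ∈ Sstar then
        ((colSub D E)ᵀ * colSub D Sstar * (gram D Sstar)⁻¹) ⟨i, h⟩ ⟨j, h'⟩
      else 0
    else 0

noncomputable def Pdiag {n : ℕ} (S : Finset (Fin n)) : Matrix (Fin n) (Fin n) ℝ :=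
  Matrix.diagonal fun i => if i ∈ S then (1 : ℝ) else 0

noncomputable def STv {n : ℕ} (μ : ℝ) (x : Fin n → ℝ) : Fin n → ℝ :=
  fun i => Real.sign (x i) * max (|x i| - μ) 0

section Eunorm

variable {α β : Type*} [Fintype α] [Fintype β]

theorem eunorm_eq_norm (v : α → ℝ) : eunorm v = ‖WithLp.toLp 2 v‖ := by
  simp [eunorm, EuclideanSpace.norm_eq]

theorem eunorm_nonneg (v : α → ℝ) : 0 ≤ eunorm v :=
  Real.sqrt_nonneg _

theorem eunorm_add_le (v w : α → ℝ) : eunorm (v + w) ≤ eunorm v + eunorm w := by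
  simp only [eunorm_eq_norm, WithLp.toLp_add]
  exact norm_add_le _ _

theorem eunorm_smul (c : ℝ) (v : α → ℝ) : eunorm (c • v) = |c| * eunorm v := by
  simp only [eunorm_eq_norm, WithLp.toLp_smul, norm_smul, Real.norm_eq_abs]

theorem abs_dotProduct_le (v w : α → ℝ) : |v ⬝ᵥ w| ≤ eunorm v * eunorm w := by
  have h := abs_real_inner_le_norm (WithLp.toLp 2 w) (WithLp.toLp 2 v)
  rw [EuclideanSpace.inner_eq_star_dotProduct] at h
  simpa [eunorm_eq_norm, mul_comm] using h

theorem eunorm_le_of_sq_le {v : α → ℝ} {c : ℝ} (hc : 0 ≤ c) (w : α → ℝ)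
    (h : ∀ i, v i ^ 2 ≤ (c * w i) ^ 2) : eunorm v ≤ c * eunorm w := by
  rw [← abs_of_nonneg hc, ← eunorm_smul]
  exact Real.sqrt_le_sqrt (Finset.sum_le_sum fun i _ => by simpa using h i)

theorem eunorm_eq_eunorm_restrict {S : Finset α} {v : α → ℝ} (hv : ∀ i ∉ S, v i = 0) :
    eunorm v = eunorm fun i : S => v i := by
  unfold eunorm
  congr 1
  rw [Finset.sum_coe_sort S fun i => v i ^ 2]
  exact (Finset.sum_subset S.subset_univ fun i _ hi => by simp [hv i hi]).symm

open scoped Matrix.Norms.L2Operator in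
open scoped Classical in
theorem l2opnorm_eq_norm (A : Matrix α β ℝ) : l2opnorm A = ‖A‖ := by
  rw [Matrix.l2_opNorm_def, ContinuousLinearMap.norm_def]
  unfold l2opnorm
  congr 1
  ext c
  refine and_congr_right fun _ => ⟨fun h x => ?_, fun h v => ?_⟩
  · simpa [eunorm_eq_norm] using! h x.ofLp
  · simpa [eunorm_eq_norm] using! h (WithLp.toLp 2 v)

open scoped Matrix.Norms.L2Operator in
open scoped Classical in
theorem eunorm_mulVec_le (A : Matrix α β ℝ) (v : β → ℝ) :
    eunorm (A *ᵥ v) ≤ l2opnorm A * eunorm v := by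
  simpa [l2opnorm_eq_norm, eunorm_eq_norm] using! A.l2_opNorm_mulVec (WithLp.toLp 2 v)

theorem l2opnorm_le {A : Matrix α β ℝ} {c : ℝ} (hc : 0 ≤ c)
    (h : ∀ v, eunorm (A *ᵥ v) ≤ c * eunorm v) : l2opnorm A ≤ c :=
  csInf_le ⟨0, fun _ hx => hx.1⟩ ⟨hc, h⟩

theorem l2opnorm_nonneg (A : Matrix α β ℝ) : 0 ≤ l2opnorm A :=
  Real.sInf_nonneg fun _ hx => hx.1

theorem eunorm_sub_smul_mulVec_le [DecidableEq α] {A : Matrix α α ℝ} (hA : A.IsHermitian)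
    {c q : ℝ} (hq : ∀ i, |1 - c * hA.eigenvalues i| ≤ q) (hq0 : 0 ≤ q) (x : α → ℝ) :
    eunorm (x - c • A *ᵥ x) ≤ q * eunorm x := by
  have key : ∀ i, inner ℝ (hA.eigenvectorBasis i) (WithLp.toLp 2 (x - c • A *ᵥ x)) =
      (1 - c * hA.eigenvalues i) * inner ℝ (hA.eigenvectorBasis i) (WithLp.toLp 2 x) := by
    intro i
    have h : (A *ᵥ x) ⬝ᵥ (hA.eigenvectorBasis i).ofLp =
        hA.eigenvalues i * (x ⬝ᵥ (hA.eigenvectorBasis i).ofLp) := by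
      have hT : Aᵀ = A := by simpa [conjTranspose_eq_transpose_of_trivial] using hA.eq
      rw [dotProduct_comm, dotProduct_mulVec, ← mulVec_transpose, hT,
        hA.mulVec_eigenvectorBasis, smul_dotProduct, smul_eq_mul, dotProduct_comm x]
    simp only [EuclideanSpace.inner_eq_star_dotProduct, star_trivial, sub_dotProduct,
      smul_dotProduct, h, smul_eq_mul]
    ring
  rw [eunorm_eq_norm, eunorm_eq_norm]
  refine le_of_sq_le_sq ?_ (by positivity)
  rw [mul_pow, ← hA.eigenvectorBasis.sum_sq_norm_inner_right,
    ← hA.eigenvectorBasis.sum_sq_norm_inner_right, Finset.mul_sum]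
  refine Finset.sum_le_sum fun i _ => ?_
  rw [key, norm_mul, mul_pow]
  gcongr
  exact hq i

end Eunorm

section Support

variable {m n : ℕ} (D : Matrix (Fin m) (Fin n) ℝ) {S : Finset (Fin n)}

theorem colSub_mulVec {w : Fin n → ℝ} (hw : ∀ i ∉ S, w i = 0) :
    colSub D S *ᵥ (fun i => w i) = D *ᵥ w := by
  ext a
  simp only [mulVec, dotProduct, colSub, submatrix_apply, id]
  rw [Finset.sum_coe_sort S fun i => D a i * w i]
  exact Finset.sum_subset S.subset_univ fun i _ hi => by simp [hw i hi]

theorem gram_mulVec_apply {w : Fin n → ℝ} (hw : ∀ i ∉ S, w i = 0) (i : {i // i ∈ S}) :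
    (gram D S *ᵥ fun i => w i) i = ((Dᵀ * D) *ᵥ w) i := by
  rw [_root_.gram, ← mulVec_mulVec, colSub_mulVec D hw, ← mulVec_mulVec]
  rfl

theorem eigenvalues_gram_le (hA : (gram D S).IsHermitian) (i : {i // i ∈ S}) :
    hA.eigenvalues i ≤ l2opnorm D ^ 2 := by
  set x := (hA.eigenvectorBasis i).ofLp with hx
  set w : Fin n → ℝ := fun j => if h : j ∈ S then x ⟨j, h⟩ else 0 with hw
  have hw0 : ∀ j ∉ S, w j = 0 := fun j hj => by simp [hw, hj]
  have hwx : (fun j : S => w j) = x := by ext j; simp [hw]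
  have hnx : eunorm x = 1 := by
    rw [eunorm_eq_norm]
    exact hA.eigenvectorBasis.orthonormal.1 i
  have hnw : eunorm w = 1 := by rw [eunorm_eq_eunorm_restrict hw0, hwx, hnx]
  have hsq : hA.eigenvalues i = eunorm (D *ᵥ w) ^ 2 := by
    rw [hA.eigenvalues_eq, ← hx, _root_.gram, ← mulVec_mulVec, dotProduct_mulVec, vecMul_transpose,
      star_trivial, ← hwx, colSub_mulVec D hw0, eunorm,
      Real.sq_sqrt (Finset.sum_nonneg fun _ _ => sq_nonneg _)]
    simp [dotProduct, sq]
  have h := eunorm_mulVec_le D w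
  rw [hnw, mul_one] at h
  rw [hsq]
  exact pow_le_pow_left₀ (eunorm_nonneg _) h 2

theorem rowMask_mulVec (S : Finset (Fin n)) (M : Matrix (Fin n) (Fin n) ℝ) (v : Fin n → ℝ) :
    rowMask S M *ᵥ v = restrVec S (M *ᵥ v) := by
  ext i
  by_cases h : i ∈ S <;> simp [rowMask, restrVec, mulVec, dotProduct, h]

theorem rowMask_sub (S : Finset (Fin n)) (M M' : Matrix (Fin n) (Fin n) ℝ) :
    rowMask S (M - M') = rowMask S M - rowMask S M' := by
  ext i j
  by_cases h : i ∈ S <;> simp [rowMask, h]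

theorem restrVec_add (S : Finset (Fin n)) (v w : Fin n → ℝ) :
    restrVec S (v + w) = restrVec S v + restrVec S w := by
  ext i
  by_cases h : i ∈ S <;> simp [restrVec, h]

theorem eunorm_restrVec_le (S : Finset (Fin n)) (v : Fin n → ℝ) :
    eunorm (restrVec S v) ≤ eunorm v := by
  rw [← one_mul (eunorm v)]
  refine eunorm_le_of_sq_le zero_le_one v fun i => ?_
  by_cases h : i ∈ S <;> simp [restrVec, h, sq_nonneg]

theorem eunorm_restrVec_Gmat_mulVec_le (hA : (gram D S).IsHermitian) {L μ : ℝ} (hL0 : 0 < L)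
    (hL : l2opnorm D ^ 2 ≤ L) (hμ : ∀ i, μ ≤ hA.eigenvalues i) (hμL : μ ≤ L)
    {w : Fin n → ℝ} (hw : ∀ i ∉ S, w i = 0) :
    eunorm (restrVec S (Gmat D L *ᵥ w)) ≤ (1 - μ / L) * eunorm w := by
  have hoff : ∀ i ∉ S, restrVec S (Gmat D L *ᵥ w) i = 0 := fun i hi => by simp [restrVec, hi]
  have hcoord : (fun i : S => restrVec S (Gmat D L *ᵥ w) i) =
      (fun i : S => w i) - (1 / L) • gram D S *ᵥ fun i : S => w i := by
    ext i
    simp [restrVec, Gmat, sub_mulVec, smul_mulVec, gram_mulVec_apply D hw]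
  rw [eunorm_eq_eunorm_restrict hoff, hcoord, eunorm_eq_eunorm_restrict hw]
  refine eunorm_sub_smul_mulVec_le hA (fun i => ?_) (sub_nonneg.2 ((div_le_one hL0).2 hμL)) _
  have h1 : hA.eigenvalues i / L ≤ 1 :=
    (div_le_one hL0).2 ((eigenvalues_gram_le D hA i).trans hL)
  have h2 : μ / L ≤ hA.eigenvalues i / L := by gcongr; exact hμ i
  rw [one_div_mul_eq_div, abs_of_nonneg (by linarith)]
  linarith

theorem Jstar_apply_of_notMem (y : Fin m → ℝ) (l : Fin m) (z : Fin n → ℝ) {i : Fin n}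
    (hi : i ∉ S) (j : Fin n) : Jstar D y l z S i j = 0 := by
  simp [Jstar, hi]

theorem Jstar_eq_rowMask (y : Fin m → ℝ) (l : Fin m) (L : ℝ) (z : Fin n → ℝ)
    (hG : IsUnit (gram D S)) :
    Jstar D y l z S = rowMask S (Gmat D L * Jstar D y l z S + umat D y l L z) := by
  ext i j
  by_cases hi : i ∈ S
  · have hcol : ((Dᵀ * D) * Jstar D y l z S) i j = -Nmat D y l z i j := by
      have h := gram_mulVec_apply D (w := fun k => Jstar D y l z S k j)
        (fun k hk => Jstar_apply_of_notMem D y l z hk j) ⟨i, hi⟩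
      have hmul : gram D S * -((gram D S)⁻¹ *
          (Nmat D y l z).submatrix (Subtype.val : {i // i ∈ S} → Fin n) id) =
          -(Nmat D y l z).submatrix (Subtype.val : {i // i ∈ S} → Fin n) id := by
        rw [Matrix.mul_neg, Matrix.mul_nonsing_inv_cancel_left _ _
          ((Matrix.isUnit_iff_isUnit_det _).1 hG)]
      have hN := congrFun (congrFun hmul ⟨i, hi⟩) j
      rw [mul_apply] at hN
      have hJ : ∀ k : {i // i ∈ S}, Jstar D y l z S k j = (-((gram D S)⁻¹ *
          (Nmat D y l z).submatrix (Subtype.val : {i // i ∈ S} → Fin n) id)) k j := by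
        intro k
        simp [Jstar]
      simp only [← hJ] at hN
      exact h.symm.trans hN
    simp only [rowMask, of_apply, if_pos hi, Gmat, umat, Matrix.sub_mul, Matrix.one_mul,
      Matrix.smul_mul, Matrix.add_apply, Matrix.sub_apply, Matrix.smul_apply, hcol, smul_eq_mul]
    ring
  · simp [rowMask, Jstar, hi]

theorem eunorm_umat_sub_mulVec_le (y : Fin m → ℝ) (l : Fin m) {L : ℝ} (hL0 : 0 < L)
    (z z' v : Fin n → ℝ) :
    eunorm ((umat D y l L z - umat D y l L z') *ᵥ v) ≤
      2 / L * eunorm (D l) * eunorm (z - z') * eunorm v := by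
  have h : (umat D y l L z - umat D y l L z') *ᵥ v =
      (-(1 / L)) • (((z - z') ⬝ᵥ v) • D l + (D l ⬝ᵥ (z - z')) • v) := by
    simp only [umat, Nmat, ← smul_sub, smul_mulVec]
    congr 1
    rw [add_sub_add_comm, ← vecMulVec_sub, ← sub_smul, sub_sub_sub_cancel_right, ← dotProduct_sub,
      add_mulVec, smul_mulVec, one_mulVec, vecMulVec_mulVec]
    ext i
    simp [mul_comm]
  rw [h, eunorm_smul, abs_neg, abs_of_pos (by positivity)]
  have h1 := abs_dotProduct_le (z - z') v
  have h2 := abs_dotProduct_le (D l) (z - z')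
  have h3 := eunorm_add_le (((z - z') ⬝ᵥ v) • D l) ((D l ⬝ᵥ (z - z')) • v)
  rw [eunorm_smul, eunorm_smul] at h3
  calc 1 / L * _ ≤ 1 / L * (eunorm (z - z') * eunorm v * eunorm (D l) +
        eunorm (D l) * eunorm (z - z') * eunorm v) := by
        have := eunorm_nonneg (D l)
        have := eunorm_nonneg v
        gcongr
        exact h3.trans (by gcongr)
    _ = _ := by ring

end Support

/-- quasi-linear convergence of the Jacobian estimate once the
iterates lie on the support (Corollary 1 of the paper). -/
theorem jacobian_convergence_on_support
    {m n : ℕ} (D : Matrix (Fin m) (Fin n) ℝ) (y : Fin m → ℝ) (l : Fin m)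
    (L : ℝ) (hL : l2opnorm D ^ 2 ≤ L) (zstar : Fin n → ℝ)
    (hGram : IsUnit (gram D (supp zstar)))
    (hHerm : (gram D (supp zstar)).IsHermitian)
    (μ : ℝ) (hμpos : 0 < μ)
    (hμle : ∀ i, μ ≤ hHerm.eigenvalues i)
    (hμmem : ∃ i, hHerm.eigenvalues i = μ)
    (K N : ℕ) (hK1 : 1 ≤ K) (hKN : K ≤ N)
    (Δ : ℝ) (hΔ : 0 ≤ Δ)
    (zseq : ℕ → Fin n → ℝ)
    (hsupp : ∀ k, N - K ≤ k → k ≤ N → supp (zseq k) = supp zstar)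
    (hrate : ∀ k, N - K ≤ k → k ≤ N →
      eunorm (zseq k - zstar) ≤ (1 - μ / L) ^ (k - (N - K)) * (2 * Δ / L))
    (Jfun : ℕ → Matrix (Fin n) (Fin n) ℝ)
    (hJ0 : Jfun (N - K) = 0)
    (hJstep : ∀ k, N - K ≤ k → k + 1 ≤ N →
      Jfun (k + 1) = rowMask (supp zstar)
        (Gmat D L * Jfun k + umat D y l L (zseq k))) :
    l2opnorm (Jfun N - Jstar D y l zstar (supp zstar)) ≤
      (1 - μ / L) ^ K * l2opnorm (Jstar D y l zstar (supp zstar))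
        + K * (1 - μ / L) ^ (K - 1) * eunorm (D l) * (4 * Δ / L ^ 2) := by
  set S := supp zstar
  set Js := Jstar D y l zstar S
  obtain ⟨i₀, hi₀⟩ := hμmem
  have hμL : μ ≤ L := hi₀ ▸ (eigenvalues_gram_le D hHerm i₀).trans hL
  have hL0 : 0 < L := hμpos.trans_le hμL
  have hq0 : 0 ≤ 1 - μ / L := sub_nonneg.2 ((div_le_one hL0).2 hμL)
  set q := 1 - μ / L
  set C := eunorm (D l) * (4 * Δ / L ^ 2) with hC
  have hC0 : 0 ≤ C := mul_nonneg (eunorm_nonneg _) (by positivity)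
  have hoff : ∀ j ≤ K, ∀ v, ∀ i ∉ S, ((Jfun (N - K + j) - Js) *ᵥ v) i = 0 := by
    intro j hj v i hi
    have hrow : (Jfun (N - K + j) - Js) i = 0 := by
      ext k
      have hJs : Js i k = 0 := Jstar_apply_of_notMem D y l zstar hi k
      cases j with
      | zero => simp [hJ0, hJs]
      | succ j =>
        rw [← add_assoc, hJstep _ (by omega) (by omega)]
        simp [rowMask, hi, hJs]
    rw [mulVec, hrow, zero_dotProduct]
  have main : ∀ j ≤ K, ∀ v, eunorm ((Jfun (N - K + j) - Js) *ᵥ v) ≤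
      (q ^ j * l2opnorm Js + j * q ^ (j - 1) * C) * eunorm v := by
    intro j
    induction j with
    | zero =>
      intro _ v
      have h : (Jfun (N - K + 0) - Js) *ᵥ v = (-1 : ℝ) • (Js *ᵥ v) := by
        simp [hJ0, neg_mulVec]
      rw [h, eunorm_smul]
      simpa using eunorm_mulVec_le Js v
    | succ j ih =>
      intro hj v
      have hstep : (Jfun (N - K + (j + 1)) - Js) *ᵥ v =
          restrVec S (Gmat D L *ᵥ ((Jfun (N - K + j) - Js) *ᵥ v)) +
            restrVec S ((umat D y l L (zseq (N - K + j)) - umat D y l L zstar) *ᵥ v) := by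
        have hfix : Js = rowMask S (Gmat D L * Js + umat D y l L zstar) :=
          Jstar_eq_rowMask D y l L zstar hGram
        rw [← add_assoc, hJstep _ (by omega) (by omega), ← restrVec_add, mulVec_mulVec,
          ← add_mulVec, ← rowMask_mulVec]
        conv_lhs => rw [hfix]
        rw [← rowMask_sub, add_sub_add_comm, ← Matrix.mul_sub]
      have h1 := eunorm_restrVec_Gmat_mulVec_le D hHerm hL0 hL hμle hμL (hoff j (by omega) v)
      have h2 := (eunorm_restrVec_le S _).trans
        (eunorm_umat_sub_mulVec_le D y l hL0 (zseq (N - K + j)) zstar v)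
      have h3 : eunorm (zseq (N - K + j) - zstar) ≤ q ^ j * (2 * Δ / L) := by
        simpa using hrate (N - K + j) (by omega) (by omega)
      have hv := eunorm_nonneg v
      have hD := eunorm_nonneg (D l)
      have hpow : q * (j * q ^ (j - 1)) = j * q ^ j := by
        cases j with
        | zero => simp
        | succ j => simp only [Nat.add_sub_cancel]; ring
      rw [hstep]
      calc _ ≤ _ := eunorm_add_le _ _
        _ ≤ q * ((q ^ j * l2opnorm Js + j * q ^ (j - 1) * C) * eunorm v) +
            2 / L * eunorm (D l) * (q ^ j * (2 * Δ / L)) * eunorm v := by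
          refine add_le_add (h1.trans ?_) (h2.trans ?_)
          · gcongr
            exact ih (by omega) v
          · gcongr
        _ = (q ^ (j + 1) * l2opnorm Js + (q * (j * q ^ (j - 1)) + q ^ j) * C) * eunorm v := by
          rw [hC]
          ring
        _ = _ := by
          rw [hpow]
          push_cast
          ring
  rw [mul_assoc _ (eunorm (D l))]
  have hfin := main K le_rfl
  rw [Nat.sub_add_cancel hKN] at hfin
  exact l2opnorm_le (add_nonneg (mul_nonneg (pow_nonneg hq0 _) (l2opnorm_nonneg _))
    (mul_nonneg (by positivity) hC0)) hfin
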